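/- Let K be a tame family of compact subsets of a strongly locally homogeneous completely metrizable space X. Then for any discrete decompositions A, B ⊆ K ∪ {{x} : x ∈ X} of X, the set of (A,B)-liftable homeomorphisms is dense in the homeomorphism space H°(A°, B°) of homeomorphisms of pairs (X/A, A°) → (X/B, B°), endowed with the strong limitation topology. -/

import Mathlib

open Set Topology unitInterval

noncomputable section

/-! ### General notions -/

/-- `X` is completely metrizable: its topology is generated by a complete metric. -/
def CompletelyMetrizable (X : Type*) [t : TopologicalSpace X] : Prop :=
  ∃ m : MetricSpace X, m.toUniformSpace.toTopologicalSpace = t ∧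
    @CompleteSpace X m.toUniformSpace

/-- The model cube `I^n` for `n ≤ ω`: `some k` codes the finite cube `I^k`,
`none` codes the Hilbert cube `I^ω`. -/
def ModelCube : Option ℕ → Type
  | some k => Fin k → unitInterval
  | none => ℕ → unitInterval

instance : (n : Option ℕ) → TopologicalSpace (ModelCube n)
  | some k => inferInstanceAs (TopologicalSpace (Fin k → unitInterval))
  | none => inferInstanceAs (TopologicalSpace (ℕ → unitInterval))

/-- A manifold modeled on `E`: a paracompact space each point of which has an open
neighborhood homeomorphic to an open subset of `E`. -/
def IsManifoldModeledOn (M : Type*) [TopologicalSpace M] (E : Type*) [TopologicalSpace E] :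
    Prop :=
  ParacompactSpace M ∧
    ∀ x : M, ∃ O : Set M, IsOpen O ∧ x ∈ O ∧ ∃ U : Set E, IsOpen U ∧ Nonempty (↥O ≃ₜ ↥U)

/-- The pair `(X, A)` is homeomorphic to the pair `(Y, B)`. -/
def PairHomeo {X Y : Type*} [TopologicalSpace X] [TopologicalSpace Y]
    (A : Set X) (B : Set Y) : Prop :=
  ∃ e : X ≃ₜ Y, ⇑e '' A = B

/-- The cube `I^n` sitting inside `ℝ^n`. -/
def stdCube (n : ℕ) : Set (Fin n → ℝ) := {f | ∀ i, f i ∈ Icc (0 : ℝ) 1}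

/-- The copy of `I^ω × [0,1]` sitting inside `I^ω × [0,2)`. -/
def hilbertCollar : Set ((ℕ → unitInterval) × ↥(Ico (0 : ℝ) 2)) := {p | (p.2 : ℝ) ≤ 1}

/-- The Hilbert cube `I^ω`. -/
abbrev HilbertCube : Type := ℕ → unitInterval

/-- The space `I^ω × [0,1)`. -/
abbrev HilbertHalfOpen : Type := HilbertCube × ↥(Ico (0 : ℝ) 1)

/-- `B` is a tame ball in the `I^n`-manifold `M`: it has an open neighborhood `O` such
that the pair `(O, B)` is homeomorphic to `(ℝ^n, I^n)` (for finite `n`), resp. to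
`(I^ω × [0,2), I^ω × [0,1])` (for `n = ω`). -/
def IsTameBall (n : Option ℕ) {M : Type*} [TopologicalSpace M] (B : Set M) : Prop :=
  ∃ O : Set M, IsOpen O ∧ B ⊆ O ∧
    match n with
    | some k => PairHomeo {x : ↥O | (x : M) ∈ B} (stdCube k)
    | none => PairHomeo {x : ↥O | (x : M) ∈ B} hilbertCollar

/-- The family of all tame balls of the `I^n`-manifold `X`. -/
def tameBalls (n : Option ℕ) (X : Type*) [TopologicalSpace X] : Set (Set X) :=
  {B | IsTameBall n B}

/-- A family of subsets of `X` is vanishing if for any open cover `𝒰` of `X` the subfamily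
of sets contained in no member of `𝒰` is locally finite in `X`. -/
def VanishingFamily {X : Type*} [TopologicalSpace X] (F : Set (Set X)) : Prop :=
  ∀ 𝒰 : Set (Set X), (∀ u ∈ 𝒰, IsOpen u) → ⋃₀ 𝒰 = univ →
    LocallyFinite (fun A : {A : Set X // A ∈ F ∧ ∀ u ∈ 𝒰, ¬ A ⊆ u} => (A : Set X))

/-- The family of connected components of the complement of `S`. -/
def complComponents {X : Type*} [TopologicalSpace X] (S : Set X) : Set (Set X) :=
  {C | ∃ x ∈ Sᶜ, C = connectedComponentIn Sᶜ x}

/-- A spongy subset of an `I^n`-manifold. -/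
def IsSpongy (n : Option ℕ) {M : Type*} [TopologicalSpace M] (S : Set M) : Prop :=
  IsClosed S ∧ IsNowhereDense S ∧
  VanishingFamily (complComponents S) ∧
  (∀ C ∈ complComponents S, ∀ C' ∈ complComponents S, C ≠ C' →
    closure C ∩ closure C' = ∅) ∧
  ∀ C ∈ complComponents S, IsTameBall n (closure C)

/-- `S` is a universal nowhere dense subset of `M`. -/
def UniversalNowhereDense {M : Type*} [TopologicalSpace M] (S : Set M) : Prop :=
  IsNowhereDense S ∧ ∀ A : Set M, IsNowhereDense A → ∃ h : M ≃ₜ M, ⇑h '' A ⊆ S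

/-- `(f, g) ≺ 𝒜` : for each `z` with `f z ≠ g z` the doubleton `{f z, g z}` lies in some
member of `𝒜`. -/
def Near {Z X : Type*} (f g : Z → X) (𝒜 : Set (Set X)) : Prop :=
  ∀ z : Z, f z ≠ g z → ∃ A ∈ 𝒜, f z ∈ A ∧ g z ∈ A

/-- The star `St(A, 𝒰)` of a set `A` with respect to a family `𝒰`. -/
def covStar {X : Type*} (A : Set X) (𝒰 : Set (Set X)) : Set X :=
  ⋃₀ {u ∈ 𝒰 | (u ∩ A).Nonempty}

/-- A compact set `K ⊆ X` is locally shrinkable if for each open neighborhood `O` of `K`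
and each open cover `𝒱` of `O` there is a homeomorphism of `X` supported in `O` moving `K`
into a member of `𝒱`. -/
def LocallyShrinkable {X : Type*} [TopologicalSpace X] (K : Set X) : Prop :=
  ∀ O : Set X, IsOpen O → K ⊆ O →
    ∀ 𝒱 : Set (Set X), (∀ v ∈ 𝒱, IsOpen v ∧ v ⊆ O) → O ⊆ ⋃₀ 𝒱 →
      ∃ h : X ≃ₜ X, (∀ x ∉ O, h x = x) ∧ ∃ v ∈ 𝒱, ⇑h '' K ⊆ v

/-- A family of sets is ambiently invariant if it is invariant under images of
homeomorphisms of the ambient space. -/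
def AmbientlyInvariant {X : Type*} [TopologicalSpace X] (𝒦 : Set (Set X)) : Prop :=
  ∀ h : X ≃ₜ X, ∀ K ∈ 𝒦, ⇑h '' K ∈ 𝒦

/-- The local shift property of a family of sets. -/
def LocalShiftProperty {X : Type*} [TopologicalSpace X] (𝒦 : Set (Set X)) : Prop :=
  ∀ x : X, ∀ O ∈ 𝓝 x, ∃ U ∈ 𝓝 x, U ⊆ O ∧
    ∀ A ∈ 𝒦, ∀ B ∈ 𝒦, A ⊆ U → B ⊆ U →
      ∃ h : X ≃ₜ X, ⇑h '' A = B ∧ ∀ y ∉ O, h y = y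

/-- A tame family of compact subsets of `X`. -/
def IsTameFamily {X : Type*} [TopologicalSpace X] (𝒦 : Set (Set X)) : Prop :=
  (∀ K ∈ 𝒦, IsCompact K) ∧ AmbientlyInvariant 𝒦 ∧ (∀ K ∈ 𝒦, LocallyShrinkable K) ∧
    LocalShiftProperty 𝒦 ∧ ∀ U : Set X, IsOpen U → U.Nonempty → ∃ K ∈ 𝒦, K ⊆ U

/-- `X` is strongly locally homogeneous. -/
def StronglyLocallyHomogeneous (X : Type*) [TopologicalSpace X] : Prop :=
  ∀ x : X, ∀ O ∈ 𝓝 x, ∃ U ∈ 𝓝 x, U ⊆ O ∧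
    ∀ y ∈ U, ∃ h : X ≃ₜ X, h x = y ∧ ∀ z ∉ O, h z = z

/-- `X` is topologically homogeneous. -/
def TopologicallyHomogeneous (X : Type*) [TopologicalSpace X] : Prop :=
  ∀ x y : X, ∃ h : X ≃ₜ X, h x = y

/-- `A` is σ-discrete in `X`: a countable union of closed discrete subsets of `X`. -/
def SigmaDiscrete {X : Type*} [TopologicalSpace X] (A : Set X) : Prop :=
  ∃ f : ℕ → Set X, A = ⋃ n, f n ∧ ∀ n, IsClosed (f n) ∧ DiscreteTopology ↥(f n)

/-! ### Decompositions -/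

/-- A decomposition of a topological space `X`: a cover of `X` by pairwise disjoint
nonempty compact subsets. -/
structure Decomposition (X : Type*) [TopologicalSpace X] where
  pieces : Set (Set X)
  nonempty' : ∀ A ∈ pieces, A.Nonempty
  isCompact' : ∀ A ∈ pieces, IsCompact A
  disjoint' : ∀ A ∈ pieces, ∀ B ∈ pieces, A ≠ B → Disjoint A B
  covers : ∀ x : X, ∃ A ∈ pieces, x ∈ A

namespace Decomposition

variable {X : Type*} [TopologicalSpace X] (D : Decomposition X)

/-- The decomposition space `X/D` (as a set it is the set of pieces). -/
def Space : Type _ := {A : Set X // A ∈ D.pieces}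

/-- The quotient map `q_D : X → X/D`. -/
noncomputable def q (x : X) : D.Space := ⟨(D.covers x).choose, (D.covers x).choose_spec.1⟩

/-- The quotient topology on the decomposition space. -/
instance : TopologicalSpace D.Space := TopologicalSpace.coinduced D.q inferInstance

/-- The non-degeneracy part `D°` of a decomposition, viewed inside the decomposition
space. -/
def nondeg : Set D.Space := {A | ¬ (A.1 : Set X).Subsingleton}

/-- The union of the non-degenerate pieces of a decomposition. -/
def nondegUnion : Set X := ⋃₀ {A ∈ D.pieces | ¬ A.Subsingleton}

/-- A `D`-saturated subset of `X`. -/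
def Saturated (U : Set X) : Prop := ∀ A ∈ D.pieces, (A ∩ U).Nonempty → A ⊆ U

/-- A decomposition is upper semicontinuous if saturations of closed sets are closed. -/
def IsUSC : Prop :=
  ∀ F : Set X, IsClosed F → IsClosed (⋃₀ {A ∈ D.pieces | (A ∩ F).Nonempty})

/-- A decomposition is vanishing if for every open cover `𝒰` of `X` the family of pieces
contained in no member of `𝒰` is discrete in `X`. -/
def Vanishing : Prop :=
  ∀ 𝒰 : Set (Set X), (∀ u ∈ 𝒰, IsOpen u) → ⋃₀ 𝒰 = univ →
    ∀ x : X, ∃ V ∈ 𝓝 x, ∀ A ∈ D.pieces, (∀ u ∈ 𝒰, ¬ A ⊆ u) →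
      ∀ B ∈ D.pieces, (∀ u ∈ 𝒰, ¬ B ⊆ u) →
        (V ∩ A).Nonempty → (V ∩ B).Nonempty → A = B

/-- The restriction of `D` to a (`D`-saturated open) set `U` is shrinkable: for each
`D`-saturated open cover `𝒰` of `U` and each open cover `𝒱` of `U` there is a
homeomorphism `h` of the subspace `U` with `(h, id) ≺ 𝒰` and `{h(A) : A ∈ D, A ⊆ U} ≺ 𝒱`. -/
def ShrinkableOn (U : Set X) : Prop :=
  ∀ 𝒰 : Set (Set X),
    (∀ u ∈ 𝒰, IsOpen u ∧ u ⊆ U ∧ ∀ A ∈ D.pieces, A ⊆ U → (A ∩ u).Nonempty → A ⊆ u) →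
    U ⊆ ⋃₀ 𝒰 →
    ∀ 𝒱 : Set (Set X), (∀ v ∈ 𝒱, IsOpen v ∧ v ⊆ U) → U ⊆ ⋃₀ 𝒱 →
      ∃ h : ↥U ≃ₜ ↥U,
        Near (fun x : ↥U => (h x : X)) (fun x : ↥U => (x : X)) 𝒰 ∧
        ∀ A ∈ D.pieces, A ⊆ U →
          ∃ v ∈ 𝒱, (fun x : ↥U => (x : X)) '' (⇑h '' {x : ↥U | (x : X) ∈ A}) ⊆ v

/-- A decomposition is strongly shrinkable if its restriction to any `D`-saturated open
set is shrinkable. -/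
def StronglyShrinkable : Prop :=
  ∀ U : Set X, IsOpen U → D.Saturated U → D.ShrinkableOn U

/-- A decomposition is `𝒦`-tame if it is vanishing, strongly shrinkable, and all its
non-degenerate pieces belong to `𝒦`. -/
def KTame (𝒦 : Set (Set X)) : Prop :=
  D.Vanishing ∧ D.StronglyShrinkable ∧ ∀ A ∈ D.pieces, ¬ A.Subsingleton → A ∈ 𝒦

/-- A decomposition is dense if its non-degeneracy part is dense in the decomposition
space. -/
def IsDenseDecomp : Prop := Dense D.nondeg

/-- A decomposition is discrete if its non-degeneracy part is closed and discrete in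
the decomposition space. -/
def IsDiscreteDecomp : Prop := IsClosed D.nondeg ∧ DiscreteTopology ↥D.nondeg

end Decomposition

/-- A homeomorphism `φ : X/A → X/B` is `(A,B)`-liftable if it lifts to a homeomorphism
`Φ : X → X` with `q_B ∘ Φ = φ ∘ q_A`. -/
def Liftable {X : Type*} [TopologicalSpace X] (A B : Decomposition X)
    (φ : A.Space ≃ₜ B.Space) : Prop :=
  ∃ Φ : X ≃ₜ X, ∀ x : X, B.q (Φ x) = φ (A.q x)

/-- Two decompositions of `X` are topologically equivalent if some homeomorphism of `X`
maps the first family of pieces onto the second. -/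
def TopEquivDecomp {X : Type*} [TopologicalSpace X] (A B : Decomposition X) : Prop :=
  ∃ Φ : X ≃ₜ X, (fun S : Set X => ⇑Φ '' S) '' A.pieces = B.pieces

/-- A `𝒦`-spongy subset of `X`. -/
def IsKSpongy {X : Type*} [TopologicalSpace X] (𝒦 : Set (Set X)) (S : Set X) : Prop :=
  ∃ D : Decomposition X, D.KTame 𝒦 ∧ D.IsDenseDecomp ∧
    Sᶜ = ⋃ A ∈ D.pieces, interior A

/-! ### Shape notions -/

/-- `K` is point-like in `X`. -/
def PointLike {X : Type*} [TopologicalSpace X] (K : Set X) : Prop :=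
  ∀ N : Set X, IsClosed N → K ⊆ interior N →
    ∃ x ∈ interior N, Nonempty (↥(N \ K) ≃ₜ ↥(N \ {x}))

/-- `K` is contractible in `U`: the inclusion `K ↪ U` is homotopic to a constant map. -/
def ContractibleIn {X : Type*} [TopologicalSpace X] (K U : Set X) : Prop :=
  ∃ hKU : K ⊆ U, ∃ y : ↥U,
    (ContinuousMap.mk (Set.inclusion hKU) (continuous_inclusion hKU)).Homotopic
      (ContinuousMap.const ↥K y)

/-- `K` is cell-like in `X`: `K` is contractible in each of its neighborhoods. -/
def CellLike {X : Type*} [TopologicalSpace X] (K : Set X) : Prop :=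
  ∀ U : Set X, IsOpen U → K ⊆ U → ContractibleIn K U

/-- `K` is cellular (with model `E`): every neighborhood of `K` contains a neighborhood
of `K` homeomorphic to `E`. -/
def CellularIn (E : Type*) [TopologicalSpace E] {X : Type*} [TopologicalSpace X]
    (K : Set X) : Prop :=
  ∀ U : Set X, IsOpen U → K ⊆ U → ∃ V ∈ 𝓝ˢ K, V ⊆ U ∧ Nonempty (↥V ≃ₜ E)

/-- `X` is locally contractible. -/
def LocallyContractible (X : Type*) [TopologicalSpace X] : Prop :=
  ∀ x : X, ∀ U ∈ 𝓝 x, ∃ V ∈ 𝓝 x, V ⊆ U ∧ ContractibleIn V U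


/-! ### Discrete families and gluing -/

/-- A family of sets is discrete if each point has a neighborhood meeting at most one
member of the family. -/
def IsDiscreteFamily {ι X : Type*} [TopologicalSpace X] (U : ι → Set X) : Prop :=
  ∀ x : X, ∃ N ∈ 𝓝 x, ∀ i j, (N ∩ U i).Nonempty → (N ∩ U j).Nonempty → i = j

theorem IsDiscreteFamily.mono {ι X : Type*} [TopologicalSpace X] {U V : ι → Set X}
    (hU : IsDiscreteFamily U) (h : ∀ i, V i ⊆ U i) : IsDiscreteFamily V := by
  intro x
  obtain ⟨N, hN, hN'⟩ := hU x
  exact ⟨N, hN, fun i j hi hj => hN' i j (hi.mono (inter_subset_inter_right _ (h i)))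
    (hj.mono (inter_subset_inter_right _ (h j)))⟩

theorem IsDiscreteFamily.eq_of_mem {ι X : Type*} [TopologicalSpace X] {U : ι → Set X}
    (hU : IsDiscreteFamily U) {x : X} {i j : ι} (hi : x ∈ U i) (hj : x ∈ U j) : i = j := by
  obtain ⟨N, hN, hN'⟩ := hU x
  exact hN' i j ⟨x, mem_of_mem_nhds hN, hi⟩ ⟨x, mem_of_mem_nhds hN, hj⟩

/-- Each point has a neighborhood that meets no member of a discrete family except possibly
a single one. -/
theorem IsDiscreteFamily.exists_nhds {ι X : Type*} [TopologicalSpace X] {U : ι → Set X}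
    (hU : IsDiscreteFamily U) (x : X) :
    ∃ N ∈ 𝓝 x, (∀ y ∈ N, ∀ j, y ∉ U j) ∨ ∃ i, ∀ y ∈ N, ∀ j, y ∈ U j → j = i := by
  obtain ⟨N, hN, hN'⟩ := hU x
  refine ⟨N, hN, ?_⟩
  by_cases h : ∃ i, (N ∩ U i).Nonempty
  · obtain ⟨i, hi⟩ := h
    exact Or.inr ⟨i, fun y hy j hj => hN' j i ⟨y, hy, hj⟩ hi⟩
  · exact Or.inl fun y hy j hj => h ⟨j, y, hy, hj⟩

open Classical in
/-- The map equal to `F i` on `U i` and to the identity off the sets `U i`. -/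
def glueMap {ι X : Type*} (U : ι → Set X) (F : ι → X → X) (z : X) : X :=
  if h : ∃ i, z ∈ U i then F h.choose z else z

theorem glueMap_of_forall_notMem {ι X : Type*} {U : ι → Set X} {F : ι → X → X} {z : X}
    (h : ∀ i, z ∉ U i) : glueMap U F z = z :=
  dif_neg fun ⟨i, hi⟩ => h i hi

theorem glueMap_of_mem {ι X : Type*} [TopologicalSpace X] {U : ι → Set X}
    (hU : IsDiscreteFamily U) {F : ι → X → X} {z : X} {i : ι} (h : z ∈ U i) :
    glueMap U F z = F i z := by
  have h' : ∃ i, z ∈ U i := ⟨i, h⟩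
  rw [glueMap, dif_pos h', hU.eq_of_mem h'.choose_spec h]

theorem glueMap_eq_of_unique {ι X : Type*} [TopologicalSpace X] {U : ι → Set X}
    (hU : IsDiscreteFamily U) {F : ι → X → X} (hF : ∀ i, ∀ z ∉ U i, F i z = z) {z : X} {i : ι}
    (h : ∀ j, z ∈ U j → j = i) : glueMap U F z = F i z := by
  by_cases hz : z ∈ U i
  · exact glueMap_of_mem hU hz
  · rw [glueMap_of_forall_notMem fun j hj => hz (h j hj ▸ hj), hF i z hz]

theorem continuous_glueMap {ι X : Type*} [TopologicalSpace X] {U : ι → Set X}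
    (hU : IsDiscreteFamily U) {F : ι → X → X} (hF : ∀ i, ∀ z ∉ U i, F i z = z)
    (hc : ∀ i, Continuous (F i)) : Continuous (glueMap U F) := by
  refine continuous_iff_continuousAt.2 fun x => ?_
  obtain ⟨N, hN, h | ⟨i, h⟩⟩ := hU.exists_nhds x
  · refine continuousAt_id.congr ?_
    filter_upwards [hN] with y hy
    exact (glueMap_of_forall_notMem (h y hy)).symm
  · refine (hc i).continuousAt.congr ?_
    filter_upwards [hN] with y hy
    exact (glueMap_eq_of_unique hU hF (h y hy)).symm

theorem glueMap_mem_iff {ι X : Type*} [TopologicalSpace X] {U : ι → Set X}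
    (hU : IsDiscreteFamily U) {F : ι → X → X} (hmem : ∀ i z, F i z ∈ U i ↔ z ∈ U i) (i : ι)
    (z : X) : glueMap U F z ∈ U i ↔ z ∈ U i := by
  by_cases h : ∃ j, z ∈ U j
  · obtain ⟨j, hj⟩ := h
    have hj' : glueMap U F z ∈ U j := by
      rw [glueMap_of_mem hU hj]
      exact (hmem j z).2 hj
    constructor
    · intro hi
      exact hU.eq_of_mem hj' hi ▸ hj
    · intro hi
      exact hU.eq_of_mem hj hi ▸ hj'
  · rw [glueMap_of_forall_notMem fun j hj => h ⟨j, hj⟩]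

/-- A homeomorphism supported in a set preserves that set. -/
theorem Homeomorph.mem_iff_of_support {X : Type*} [TopologicalSpace X] {U : Set X}
    (h : X ≃ₜ X) (hh : ∀ z ∉ U, h z = z) (z : X) : h z ∈ U ↔ z ∈ U := by
  constructor
  · intro hz
    by_contra hzU
    exact hzU (hh z hzU ▸ hz)
  · intro hz
    by_contra hzU
    exact hzU ((h.injective (hh _ hzU)).symm ▸ hz)

theorem exists_glue_homeomorph {ι X : Type*} [TopologicalSpace X] {U : ι → Set X}
    (hU : IsDiscreteFamily U) (h : ι → X ≃ₜ X) (hh : ∀ i, ∀ z ∉ U i, h i z = z) :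
    ∃ H : X ≃ₜ X, (∀ i, ∀ z ∈ U i, H z = h i z) ∧ ∀ z, (∀ i, z ∉ U i) → H z = z := by
  have hs : ∀ i, ∀ z ∉ U i, (h i).symm z = z := fun i z hz => by
    rw [Homeomorph.symm_apply_eq, hh i z hz]
  have key : ∀ (e : ι → X ≃ₜ X), (∀ i, ∀ z ∉ U i, e i z = z) → ∀ z,
      glueMap U (fun i => (e i).symm) (glueMap U (fun i => e i) z) = z := by
    intro e he z
    by_cases hz : ∃ i, z ∈ U i
    · obtain ⟨i, hi⟩ := hz
      rw [glueMap_of_mem hU hi, glueMap_of_mem hU (((e i).mem_iff_of_support (he i) z).2 hi),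
        Homeomorph.symm_apply_apply]
    · have hz' : ∀ i, z ∉ U i := fun i hi => hz ⟨i, hi⟩
      rw [glueMap_of_forall_notMem hz', glueMap_of_forall_notMem hz']
  refine ⟨⟨⟨glueMap U fun i => h i, glueMap U fun i => (h i).symm, key h hh,
    key (fun i => (h i).symm) hs⟩, continuous_glueMap hU hh fun i => (h i).continuous,
    continuous_glueMap hU hs fun i => (h i).symm.continuous⟩, ?_, ?_⟩
  · exact fun i z hz => glueMap_of_mem (F := fun i => h i) hU hz
  · exact fun z hz => glueMap_of_forall_notMem (F := fun i => h i) hz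

/-- In a metric space a discrete family of compact sets with disjoint members expands to a
discrete family of open sets. -/
theorem IsDiscreteFamily.exists_open_expansion {ι X : Type*} [MetricSpace X]
    {P : ι → Set X} (hP : IsDiscreteFamily P) (hc : ∀ i, IsCompact (P i)) :
    ∃ U : ι → Set X, IsDiscreteFamily U ∧ ∀ i, IsOpen (U i) ∧ P i ⊆ U i := by
  have hclosed : ∀ i, IsClosed (⋃ j : {j // j ≠ i}, P j.1) := by
    intro i
    refine LocallyFinite.isClosed_iUnion (fun x => ?_) fun j => (hc j).isClosed
    obtain ⟨N, hN, hN'⟩ := hP x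
    refine ⟨N, hN, Set.Subsingleton.finite fun j hj k hk => Subtype.ext ?_⟩
    exact hN' _ _ (inter_comm _ N ▸ hj) (inter_comm _ N ▸ hk)
  have hr : ∀ i, ∃ r : ℝ, 0 < r ∧ ∀ j, j ≠ i → ∀ p ∈ P i, ∀ p' ∈ P j, r ≤ dist p p' := by
    intro i
    obtain ⟨r, hr, hsub⟩ := (hc i).exists_thickening_subset_open (hclosed i).isOpen_compl
      (by
        intro x hx hx'
        obtain ⟨j, hj⟩ := mem_iUnion.1 hx'
        exact j.2 (hP.eq_of_mem hj hx))
    refine ⟨r, hr, fun j hj p hp p' hp' => ?_⟩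
    by_contra! hlt
    refine hsub (Metric.mem_thickening_iff.2 ⟨p, hp, ?_⟩) (mem_iUnion.2 ⟨⟨j, hj⟩, hp'⟩)
    rwa [dist_comm]
  choose r hr hdist using hr
  refine ⟨fun i => Metric.thickening (r i / 4) (P i), ?_, fun i =>
    ⟨Metric.isOpen_thickening, Metric.self_subset_thickening (by linarith [hr i]) _⟩⟩
  intro x
  obtain ⟨N, hN, hN'⟩ := hP x
  obtain ⟨δ, hδ, hδN⟩ := Metric.mem_nhds_iff.1 hN
  refine ⟨Metric.ball x (δ / 2), Metric.ball_mem_nhds x (by linarith), ?_⟩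
  rintro i j ⟨y, hy, hyi⟩ ⟨z, hz, hzj⟩
  obtain ⟨p, hp, hyp⟩ := Metric.mem_thickening_iff.1 hyi
  obtain ⟨p', hp', hzp⟩ := Metric.mem_thickening_iff.1 hzj
  rw [Metric.mem_ball] at hy hz
  by_contra hij
  have h1 := hdist i j (Ne.symm hij) p hp p' hp'
  have h2 := hdist j i hij p' hp' p hp
  rw [dist_comm] at h2
  have h3 : dist p p' ≤ dist y p + dist y x + (dist z x + dist z p') := by
    have := dist_triangle_left p p' x
    have e1 := dist_triangle x y p
    have e2 := dist_triangle x z p'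
    rw [dist_comm x y] at e1
    rw [dist_comm x z] at e2
    linarith
  have h4 : dist p x < δ := by
    have := dist_triangle_left p x y
    linarith
  have h5 : dist p' x < δ := by
    have := dist_triangle_left p' x z
    linarith
  exact hij (hN' i j ⟨p, hδN h4, hp⟩ ⟨p', hδN h5, hp'⟩)

/-! ### Quotient maps with the same fibers -/

theorem exists_homeomorph_of_isQuotientMap {X Y Z : Type*} [TopologicalSpace X]
    [TopologicalSpace Y] [TopologicalSpace Z] {p : X → Y} {r : X → Z} (hp : IsQuotientMap p)
    (hr : IsQuotientMap r) (h : ∀ x y, p x = p y ↔ r x = r y) :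
    ∃ e : Y ≃ₜ Z, ∀ x, e (p x) = r x := by
  choose s hs using hp.surjective
  choose t ht using hr.surjective
  have hrs : ∀ x, r (s (p x)) = r x := fun x => (h _ _).1 (hs _)
  have hpt : ∀ x, p (t (r x)) = p x := fun x => (h _ _).2 (ht _)
  refine ⟨⟨⟨fun y => r (s y), fun z => p (t z), fun y => ?_, fun z => ?_⟩, ?_, ?_⟩, hrs⟩
  · simp only [hpt, hs]
  · simp only [hrs, ht]
  · exact hp.continuous_iff.2 (hr.continuous.congr fun x => (hrs x).symm)
  · exact hr.continuous_iff.2 (hp.continuous.congr fun x => (hpt x).symm)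

/-! ### Shrinking a single compact set to a point -/

/-- One step of the shrinking process. -/
theorem exists_shrink_step {X : Type*} [MetricSpace X] {K : Set X} (hK : IsCompact K)
    (hshr : ∀ h : X ≃ₜ X, LocallyShrinkable (h '' K)) {ε : ℝ} (hε : 0 < ε) (h : X ≃ₜ X)
    {O : Set X} (hO : IsOpen O) (hKO : ∀ z ∈ K, h z ∈ O) :
    ∃ (h' : X ≃ₜ X) (O' : Set X) (c : X), IsOpen O' ∧ closure O' ⊆ O ∧
      O' ⊆ Metric.ball c ε ∧ (∀ z ∈ K, h' z ∈ O') ∧ (∀ z, h z ∉ O → h' z = h z) ∧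
      (∀ z, h z ∈ O → h' z ∈ O) ∧ ∀ z, h' z ∈ O' → z ∈ Metric.thickening ε K := by
  obtain ⟨g, hg, v, ⟨c, rfl⟩, hv⟩ := hshr h O hO (image_subset_iff.2 hKO)
    (range fun c => O ∩ Metric.ball c ε)
    (by
      rintro _ ⟨c, rfl⟩
      exact ⟨hO.inter Metric.isOpen_ball, inter_subset_left⟩)
    (fun x hx => ⟨_, ⟨x, rfl⟩, hx, Metric.mem_ball_self hε⟩)
  have hT : IsOpen ((O ∩ Metric.ball c ε) ∩ (h.trans g).symm ⁻¹' Metric.thickening ε K) :=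
    (hO.inter Metric.isOpen_ball).inter
      (Metric.isOpen_thickening.preimage (h.trans g).symm.continuous)
  have hsub : (h.trans g) '' K ⊆
      (O ∩ Metric.ball c ε) ∩ (h.trans g).symm ⁻¹' Metric.thickening ε K := by
    rintro _ ⟨z, hz, rfl⟩
    refine ⟨hv ⟨h z, ⟨z, hz, rfl⟩, rfl⟩, ?_⟩
    rw [mem_preimage, Homeomorph.symm_apply_apply]
    exact Metric.self_subset_thickening hε K hz
  obtain ⟨O', hO', hKO', hO'T⟩ :=
    (hK.image (h.trans g).continuous).exists_isOpen_closure_subset (hT.mem_nhdsSet.2 hsub)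
  refine ⟨h.trans g, O', c, hO', fun x hx => (hO'T hx).1.1,
    fun x hx => (hO'T (subset_closure hx)).1.2, fun z hz => hKO' ⟨z, hz, rfl⟩,
    fun z hz => hg _ hz, fun z hz => (g.mem_iff_of_support hg _).2 hz, fun z hz => ?_⟩
  have := (hO'T (subset_closure hz)).2
  rwa [mem_preimage, Homeomorph.symm_apply_apply] at this

theorem exists_shrink_sequence {X : Type*} [MetricSpace X] {K U : Set X} (hK : IsCompact K)
    (hshr : ∀ h : X ≃ₜ X, LocallyShrinkable (h '' K)) (hU : IsOpen U) (hKU : K ⊆ U) :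
    ∃ (h : ℕ → X ≃ₜ X) (O : ℕ → Set X) (c : ℕ → X), O 0 = U ∧ (∀ z, h 0 z = z) ∧
      (∀ n, IsOpen (O n)) ∧ (∀ n, closure (O (n + 1)) ⊆ O n) ∧
      (∀ n : ℕ, O (n + 1) ⊆ Metric.ball (c n) (1 / ((n : ℝ) + 1))) ∧
      (∀ n, ∀ z ∈ K, h n z ∈ O n) ∧ (∀ n z, h n z ∉ O n → h (n + 1) z = h n z) ∧
      (∀ n z, h n z ∈ O n → h (n + 1) z ∈ O n) ∧
      ∀ (n : ℕ) z, h (n + 1) z ∈ O (n + 1) → z ∈ Metric.thickening (1 / ((n : ℝ) + 1)) K := by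
  let S := {s : (X ≃ₜ X) × Set X // IsOpen s.2 ∧ ∀ z ∈ K, s.1 z ∈ s.2}
  have step : ∀ (n : ℕ) (s : S), ∃ (s' : S) (c : X), closure s'.1.2 ⊆ s.1.2 ∧
      s'.1.2 ⊆ Metric.ball c (1 / ((n : ℝ) + 1)) ∧
      (∀ z, s.1.1 z ∉ s.1.2 → s'.1.1 z = s.1.1 z) ∧
      (∀ z, s.1.1 z ∈ s.1.2 → s'.1.1 z ∈ s.1.2) ∧
      ∀ z, s'.1.1 z ∈ s'.1.2 → z ∈ Metric.thickening (1 / ((n : ℝ) + 1)) K := by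
    rintro n ⟨⟨h, O⟩, hO, hKO⟩
    obtain ⟨h', O', c, h1, h2, h3, h4, h5, h6, h7⟩ :=
      exists_shrink_step hK hshr (Nat.one_div_pos_of_nat (n := n)) h hO hKO
    exact ⟨⟨⟨h', O'⟩, h1, h4⟩, c, h2, h3, h5, h6, h7⟩
  choose nxt ctr h1 h2 h3 h4 h5 using step
  let s : ℕ → S := fun n => Nat.rec ⟨⟨Homeomorph.refl X, U⟩, hU, hKU⟩ (fun n s => nxt n s) n
  exact ⟨fun n => (s n).1.1, fun n => (s n).1.2, fun n => ctr n (s n), rfl, fun z => rfl,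
    fun n => (s n).2.1, fun n => h1 n (s n), fun n => h2 n (s n), fun n => (s n).2.2,
    fun n => h3 n (s n), fun n => h4 n (s n), fun n => h5 n (s n)⟩

/-- A compact set all of whose homeomorphic images are locally shrinkable can be shrunk to a
point by a closed map supported in a given neighborhood; homeomorphisms with this support push
the set arbitrarily close to that point. -/
theorem exists_shrink_map {X : Type*} [MetricSpace X] [CompleteSpace X] {K U : Set X}
    (hK : IsCompact K) (hne : K.Nonempty) (hshr : ∀ h : X ≃ₜ X, LocallyShrinkable (h '' K))
    (hU : IsOpen U) (hKU : K ⊆ U) :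
    ∃ (H : X → X) (x : X), Continuous H ∧ Function.Surjective H ∧
      (∀ z, H z = x ↔ z ∈ K) ∧ (∀ z z', z ∉ K → z' ∉ K → H z = H z' → z = z') ∧
      (∀ z ∉ U, H z = z) ∧ (∀ z, H z ∈ U ↔ z ∈ U) ∧
      (∀ y (O : Set X), IsOpen O → H ⁻¹' {y} ⊆ O → ∀ᶠ y' in 𝓝 y, H ⁻¹' {y'} ⊆ O) ∧
      ∀ N ∈ 𝓝 x, ∃ h : X ≃ₜ X, (∀ z ∉ U, h z = z) ∧ h '' K ⊆ N := by
  classical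
  obtain ⟨h, O, c, hO0, hh0, hO, hcl, hball, hKO, hoff, hon, hthick⟩ :=
    exists_shrink_sequence hK hshr hU hKU
  have hanti : Antitone O := antitone_nat_of_succ_le fun n => subset_closure.trans (hcl n)
  have hiff : ∀ n m, n ≤ m → ∀ z, h m z ∈ O n ↔ h n z ∈ O n := by
    intro n m hnm z
    induction m, hnm using Nat.le_induction with
    | base => rfl
    | succ m hnm ih =>
      rw [← ih]
      by_cases hz : h m z ∈ O m
      · exact iff_of_true (hanti hnm (hon m z hz)) (hanti hnm hz)
      · rw [hoff m z hz]
  have hconst : ∀ n m, n ≤ m → ∀ z, h n z ∉ O n → h m z = h n z := by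
    intro n m hnm z hz
    induction m, hnm using Nat.le_induction with
    | base => rfl
    | succ m hnm ih =>
      rw [hoff m z fun hm => hz ((hiff n m hnm z).1 (hanti hnm hm)), ih]
  have hout : ∀ n m, n ≤ m → ∀ z, h n z ∉ O n → h m z ∉ O m := fun n m hnm z hz hm =>
    hz ((hiff n m hnm z).1 (hanti hnm hm))
  have hexit : ∀ z ∉ K, ∃ n, h n z ∉ O n := by
    intro z hz
    by_contra! hall
    refine hz (hK.isClosed.closure_eq ▸ Metric.mem_closure_iff.2 fun ε hε => ?_)
    obtain ⟨n, hn⟩ := exists_nat_one_div_lt hε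
    obtain ⟨p, hp, hzp⟩ := Metric.mem_thickening_iff.1 (hthick n z (hall (n + 1)))
    exact ⟨p, hp, hzp.trans hn⟩
  obtain ⟨z₀, hz₀⟩ := hne
  obtain ⟨x, hx⟩ : ∃ x, ∀ n, x ∈ O n := by
    have hcauchy : CauchySeq fun n => h n z₀ := by
      refine Metric.cauchySeq_iff'.2 fun ε hε => ?_
      obtain ⟨k, hk⟩ := exists_nat_one_div_lt (half_pos hε)
      refine ⟨k + 1, fun m hm => ?_⟩
      have h1 := hball k (hanti hm (hKO m z₀ hz₀))
      have h2 := hball k (hKO (k + 1) z₀ hz₀)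
      rw [Metric.mem_ball] at h1 h2
      have := dist_triangle_right (h m z₀) (h (k + 1) z₀) (c k)
      linarith
    obtain ⟨x, hx⟩ := cauchySeq_tendsto_of_complete hcauchy
    refine ⟨x, fun n => hcl n (mem_closure_of_tendsto hx ?_)⟩
    filter_upwards [Filter.eventually_ge_atTop (n + 1)] with m hm
    exact hanti hm (hKO m z₀ hz₀)
  have hsmall : ∀ N ∈ 𝓝 x, ∃ n, O n ⊆ N := by
    intro N hN
    obtain ⟨ε, hε, hεN⟩ := Metric.mem_nhds_iff.1 hN
    obtain ⟨k, hk⟩ := exists_nat_one_div_lt (half_pos hε)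
    refine ⟨k + 1, fun y hy => hεN ?_⟩
    have h1 := hball k hy
    have h2 := hball k (hx (k + 1))
    rw [Metric.mem_ball] at h1 h2 ⊢
    have := dist_triangle_right y x (c k)
    linarith
  have hfar : ∀ y, y ≠ x → ∃ n, y ∉ O n := fun y hy => by
    obtain ⟨n, hn⟩ := hsmall {y}ᶜ (isOpen_ne.mem_nhds hy.symm)
    exact ⟨n, fun hyn => hn hyn rfl⟩
  let H : X → X := fun z => if hz : z ∈ K then x else h (hexit z hz).choose z
  have hHK : ∀ z ∈ K, H z = x := fun z hz => dif_pos hz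
  have hHoff : ∀ n z, h n z ∉ O n → H z = h n z := by
    intro n z hz
    have hzK : z ∉ K := fun hzK => hz (hKO n z hzK)
    have hs := (hexit z hzK).choose_spec
    have hH : H z = h (hexit z hzK).choose z := dif_neg hzK
    rw [hH]
    rcases le_total n (hexit z hzK).choose with hle | hle
    · exact hconst _ _ hle z hz
    · exact (hconst _ _ hle z hs).symm
  have hHmem : ∀ n z, H z ∈ O n ↔ h n z ∈ O n := by
    intro n z
    by_cases hzK : z ∈ K
    · rw [hHK z hzK]
      exact iff_of_true (hx n) (hKO n z hzK)
    · obtain ⟨m, hm⟩ := hexit z hzK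
      rw [hHoff (max n m) z (hout m _ (le_max_right _ _) z hm)]
      exact hiff n _ (le_max_left _ _) z
  have hsurj : Function.Surjective H := by
    intro y
    by_cases hy : y = x
    · exact ⟨z₀, by rw [hHK z₀ hz₀, hy]⟩
    · obtain ⟨n, hn⟩ := hfar y hy
      refine ⟨(h n).symm y, ?_⟩
      rw [hHoff n _ (by rwa [Homeomorph.apply_symm_apply]), Homeomorph.apply_symm_apply]
  have hHx : ∀ z, H z = x ↔ z ∈ K := by
    refine fun z => ⟨fun hz => ?_, hHK z⟩
    by_contra hzK
    obtain ⟨n, hn⟩ := hexit z hzK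
    exact hn ((hHmem n z).1 (hz ▸ hx n))
  have hU' : ∀ z ∉ U, ∀ n, h n z = z := fun z hz n => by
    rw [hconst 0 n n.zero_le z (by rwa [hh0, hO0]), hh0]
  refine ⟨H, x, ?_, hsurj, hHx, ?_, ?_, ?_, ?_, ?_⟩
  · refine continuous_iff_continuousAt.2 fun z => ?_
    by_cases hzK : z ∈ K
    · rw [ContinuousAt, hHK z hzK]
      intro N hN
      obtain ⟨n, hn⟩ := hsmall N hN
      rw [Filter.mem_map]
      filter_upwards [((hO n).preimage (h n).continuous).mem_nhds (hKO n z hzK)] with y hy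
      exact hn ((hHmem n y).2 hy)
    · obtain ⟨n, hn⟩ := hexit z hzK
      have hz : z ∈ h (n + 1) ⁻¹' (closure (O (n + 1)))ᶜ := fun hz =>
        hn ((hiff n (n + 1) n.le_succ z).1 (hcl n hz))
      refine (h (n + 1)).continuous.continuousAt.congr ?_
      filter_upwards [(isClosed_closure.isOpen_compl.preimage (h (n + 1)).continuous).mem_nhds
        hz] with y hy
      exact (hHoff _ _ fun hy' => hy (subset_closure hy')).symm
  · intro z z' hz hz' heq
    obtain ⟨n, hn⟩ := hexit z hz
    obtain ⟨m, hm⟩ := hexit z' hz'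
    rw [hHoff _ z (hout n (max n m) (le_max_left _ _) z hn),
      hHoff _ z' (hout m (max n m) (le_max_right _ _) z' hm)] at heq
    exact (h _).injective heq
  · intro z hz
    rw [hHoff 0 z (by rwa [hh0, hO0]), hh0]
  · intro z
    rw [← hO0, hHmem 0 z, hh0]
  · intro y V hV hyV
    by_cases hy : y = x
    · subst hy
      obtain ⟨δ, hδ, hδV⟩ := hK.exists_thickening_subset_open hV
        fun z hz => hyV (hHK z hz)
      obtain ⟨n, hn⟩ := exists_nat_one_div_lt hδ
      filter_upwards [(hO (n + 1)).mem_nhds (hx (n + 1))] with y' hy' z hz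
      refine hδV (Metric.thickening_mono hn.le _ (hthick n z ((hHmem (n + 1) z).1 ?_)))
      rwa [show H z = y' from hz]
    · obtain ⟨n, hn⟩ := hfar y hy
      have hn' : y ∉ closure (O (n + 1)) := fun hy' => hn (hcl n hy')
      have hyO : y ∉ O (n + 1) := fun hy' => hn' (subset_closure hy')
      have hfib : (h (n + 1)).symm y ∈ V := by
        refine hyV ?_
        rw [mem_preimage, hHoff (n + 1) _ (by rwa [Homeomorph.apply_symm_apply]),
          Homeomorph.apply_symm_apply, mem_singleton_iff]
      filter_upwards [(hV.preimage (h (n + 1)).symm.continuous).mem_nhds hfib,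
        isClosed_closure.isOpen_compl.mem_nhds hn'] with y' hy' hy'O z hz
      have hz : H z = y' := hz
      have hz' : h (n + 1) z ∉ O (n + 1) := fun hz' =>
        hy'O (subset_closure (hz ▸ (hHmem _ z).2 hz'))
      rw [mem_preimage, ← hz, hHoff _ z hz', Homeomorph.symm_apply_apply] at hy'
      exact hy'
  · intro N hN
    obtain ⟨n, hn⟩ := hsmall N hN
    refine ⟨h n, fun z hz => hU' z hz n, ?_⟩
    rintro _ ⟨z, hz, rfl⟩
    exact hn (hKO n z hz)

/-! ### Decomposition spaces of discrete decompositions -/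

namespace Decomposition

variable {X : Type*} [TopologicalSpace X] (D : Decomposition X)

theorem mem_q (x : X) : x ∈ (D.q x).1 := (D.covers x).choose_spec.2

variable {D} in
theorem q_eq_of_mem {P : D.Space} {x : X} (h : x ∈ P.1) : D.q x = P := by
  by_contra hne
  exact (D.disjoint' _ (D.q x).2 _ P.2 fun e => hne (Subtype.ext e)).le_bot ⟨D.mem_q x, h⟩

theorem q_surjective : Function.Surjective D.q := fun P =>
  (D.nonempty' P.1 P.2).imp fun _ hx => q_eq_of_mem hx

theorem isQuotientMap_q : IsQuotientMap D.q := ⟨⟨rfl⟩, D.q_surjective⟩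

variable {D} in
theorem q_injective_of_notMem_nondeg {x y : X} (hx : D.q x ∉ D.nondeg) (h : D.q x = D.q y) :
    x = y :=
  not_not.1 hx (D.mem_q x) (h ▸ D.mem_q y)

variable {D} in
theorem IsDiscreteDecomp.isDiscreteFamily (hD : D.IsDiscreteDecomp) :
    IsDiscreteFamily fun P : D.nondeg => P.1.1 := by
  intro x
  by_cases hx : D.q x ∈ D.nondeg
  · obtain ⟨V, hV, hVx⟩ := isOpen_induced_iff.1
      (@isOpen_discrete _ _ hD.2 {(⟨D.q x, hx⟩ : D.nondeg)})
    have hmem : ∀ P : D.nondeg, P.1 ∈ V → P = ⟨D.q x, hx⟩ := fun P hP => by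
      have : P ∈ Subtype.val ⁻¹' V := hP
      rwa [hVx] at this
    have hxV : (⟨D.q x, hx⟩ : D.nondeg) ∈ Subtype.val ⁻¹' V := by
      rw [hVx]
      rfl
    refine ⟨D.q ⁻¹' V, (hV.preimage D.isQuotientMap_q.continuous).mem_nhds hxV, ?_⟩
    rintro P Q ⟨y, hyV, hyP⟩ ⟨z, hzV, hzQ⟩
    rw [mem_preimage, q_eq_of_mem hyP] at hyV
    rw [mem_preimage, q_eq_of_mem hzQ] at hzV
    rw [hmem P hyV, hmem Q hzV]
  · refine ⟨D.q ⁻¹' D.nondegᶜ,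
      (hD.1.isOpen_compl.preimage D.isQuotientMap_q.continuous).mem_nhds hx, ?_⟩
    rintro P Q ⟨y, hyV, hyP⟩ -
    rw [mem_preimage, q_eq_of_mem hyP] at hyV
    exact absurd P.2 hyV

variable {D} in
/-- The quotient map of a discrete decomposition into locally shrinkable pieces is a near
homeomorphism. -/
theorem exists_homeomorph_space (hX : CompletelyMetrizable X)
    (hshr : ∀ P ∈ D.nondeg, ∀ h : X ≃ₜ X, LocallyShrinkable (h '' P.1))
    {U : D.nondeg → Set X} (hU : IsDiscreteFamily U)
    (hUo : ∀ P, IsOpen (U P)) (hPU : ∀ P, P.1.1 ⊆ U P) :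
    ∃ η : D.Space ≃ₜ X, (∀ P z, η (D.q z) ∈ U P ↔ z ∈ U P) ∧
      (∀ z, (∀ P, z ∉ U P) → η (D.q z) = z) ∧
      ∀ P : D.nondeg, ∀ N ∈ 𝓝 (η P.1), ∃ h : X ≃ₜ X, (∀ z ∉ U P, h z = z) ∧
        h '' P.1.1 ⊆ N := by
  obtain ⟨m, rfl, hcomplete⟩ := hX
  have hex := fun P : D.nondeg => exists_shrink_map (D.isCompact' _ P.1.2)
    (D.nonempty' _ P.1.2) (hshr P.1 P.2) (hUo P) (hPU P)
  choose F x hFc hFs hFx hFinj hFoff hFmem hFcl hFh using hex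
  let H := glueMap U F
  have hHmem : ∀ P z, H z ∈ U P ↔ z ∈ U P := glueMap_mem_iff hU hFmem
  have hHof : ∀ z, (∀ P, z ∉ U P) → H z = z := fun z hz => glueMap_of_forall_notMem hz
  have hHin : ∀ P z, z ∈ U P → H z = F P z := fun P z hz => glueMap_of_mem hU hz
  have hHc : Continuous H := continuous_glueMap hU hFoff hFc
  have hHs : Function.Surjective H := by
    intro y
    by_cases hy : ∃ P, y ∈ U P
    · obtain ⟨P, hP⟩ := hy
      obtain ⟨z, rfl⟩ := hFs P y
      exact ⟨z, hHin P z ((hFmem P z).1 hP)⟩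
    · exact ⟨y, hHof y fun P hP => hy ⟨P, hP⟩⟩
  have hHcl : IsClosedMap H := by
    intro C hC
    rw [← isOpen_compl_iff, isOpen_iff_mem_nhds]
    intro y hy
    have hfib : H ⁻¹' {y} ⊆ Cᶜ := fun z hz hzC => hy ⟨z, hzC, hz⟩
    suffices ∀ᶠ y' in 𝓝 y, H ⁻¹' {y'} ⊆ Cᶜ by
      filter_upwards [this] with y' hy'
      rintro ⟨z, hzC, hz⟩
      exact hy' hz hzC
    obtain ⟨N, hN, h | ⟨P, h⟩⟩ := hU.exists_nhds y
    · have hid : ∀ z, H z ∈ N → H z = z := fun z hz =>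
        hHof z fun P hP => h _ hz P ((hHmem P z).2 hP)
      filter_upwards [hN, hC.isOpen_compl.mem_nhds
        (hfib (hHof y (h y (mem_of_mem_nhds hN))))] with y' hy'N hy' z hz
      have hz : H z = y' := hz
      rwa [← hid z (hz ▸ hy'N), hz]
    · have hfibN : ∀ y' ∈ N, H ⁻¹' {y'} = F P ⁻¹' {y'} := by
        intro y' hy'
        ext z
        have hiff : ∀ Q, H z ∈ U Q ↔ z ∈ U Q := fun Q => hHmem Q z
        constructor
        · intro hz
          have hz : H z = y' := hz
          have : H z = F P z := glueMap_eq_of_unique hU hFoff fun Q hQ =>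
            h _ hy' Q (hz ▸ (hiff Q).2 hQ)
          exact this.symm.trans hz
        · intro hz
          have hz : F P z = y' := hz
          by_cases hzP : z ∈ U P
          · exact (hHin P z hzP).trans hz
          · have hzy : z = y' := (hFoff P z hzP).symm.trans hz
            exact (hHof z fun Q hQ => hzP (h z (hzy ▸ hy') Q hQ ▸ hQ)).trans hzy
      rw [hfibN y (mem_of_mem_nhds hN)] at hfib
      filter_upwards [hFcl P y _ hC.isOpen_compl hfib, hN] with y' hy' hy'N
      rwa [hfibN y' hy'N]
  have hHnd : ∀ (P : D.nondeg) z, H z = x P ↔ z ∈ P.1.1 := by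
    intro P z
    have hxU : x P ∈ U P := by
      obtain ⟨p, hp⟩ := D.nonempty' _ P.1.2
      rw [← (hFx P p).2 hp]
      exact (hFmem P p).2 (hPU P hp)
    constructor
    · intro hz
      have hzU : z ∈ U P := (hHmem P z).1 (hz ▸ hxU)
      exact (hFx P z).1 ((hHin P z hzU).symm.trans hz)
    · intro hz
      exact (hHin P z (hPU P hz)).trans ((hFx P z).2 hz)
  have hfibers : ∀ z z', D.q z = D.q z' ↔ H z = H z' := by
    intro z z'
    by_cases hz : D.q z ∈ D.nondeg
    · rw [(hHnd ⟨_, hz⟩ z).2 (D.mem_q z), @eq_comm _ (x _), hHnd ⟨_, hz⟩ z']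
      exact ⟨fun h => (congrArg (fun Q : D.Space => z' ∈ Q.1) h).mpr (D.mem_q z'), fun h => (q_eq_of_mem h).symm⟩
    refine ⟨fun h => by rw [q_injective_of_notMem_nondeg hz h], fun h => ?_⟩
    have hnot : ∀ w, H w = H z → ∀ P : D.nondeg, w ∉ P.1.1 := fun w hw P hwP =>
      hz (q_eq_of_mem ((hHnd P z).1 (hw.symm.trans ((hHnd P w).2 hwP))) ▸ P.2)
    by_cases hzU : ∃ P, z ∈ U P
    · obtain ⟨P, hP⟩ := hzU
      have hP' : z' ∈ U P := (hHmem P z').1 (h ▸ (hHmem P z).2 hP)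
      have h' := h
      rw [hHin P z hP, hHin P z' hP'] at h'
      rw [hFinj P z z' (hnot z rfl P) (hnot z' h.symm P) h']
    · have hz1 : ∀ P, z ∉ U P := fun P hP => hzU ⟨P, hP⟩
      have hz2 : ∀ P, z' ∉ U P := fun P hP =>
        hz1 P ((hHmem P z).1 (h ▸ (hHmem P z').2 hP))
      rw [hHof z hz1, hHof z' hz2] at h
      rw [h]
  obtain ⟨η, hη⟩ := exists_homeomorph_of_isQuotientMap D.isQuotientMap_q
    (hHcl.isQuotientMap hHc hHs) hfibers
  refine ⟨η, fun P z => by rw [hη]; exact hHmem P z, fun z hz => by rw [hη]; exact hHof z hz,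
    fun P N hN => hFh P N ?_⟩
  obtain ⟨p, hp⟩ := D.nonempty' _ P.1.2
  rwa [← q_eq_of_mem hp, hη, (hHnd P p).2 hp] at hN

variable {D} in
theorem exists_open_expansion (hX : CompletelyMetrizable X) (hD : D.IsDiscreteDecomp) :
    ∃ U : D.nondeg → Set X, IsDiscreteFamily U ∧ ∀ P, IsOpen (U P) ∧ P.1.1 ⊆ U P := by
  obtain ⟨m, rfl, -⟩ := hX
  exact hD.isDiscreteFamily.exists_open_expansion fun P => D.isCompact' _ P.1.2

variable {D} in
theorem mem_of_mem_nondeg {𝒦 : Set (Set X)} (h : ∀ P ∈ D.pieces, P ∈ 𝒦 ∨ ∃ x : X, P = {x})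
    {P : D.Space} (hP : P ∈ D.nondeg) : P.1 ∈ 𝒦 := by
  refine (h P.1 P.2).resolve_right ?_
  rintro ⟨x, hx⟩
  refine hP ?_
  rw [hx]
  exact subsingleton_singleton

/-- A homeomorphism carrying the non-degenerate pieces of one decomposition onto the
non-degenerate pieces of another induces a homeomorphism of the decomposition spaces. -/
theorem exists_homeomorph_of_image_eq {A B : Decomposition X} (f : A.Space → B.Space)
    (hf : f '' A.nondeg = B.nondeg) (hinj : Function.Injective f) (Φ : X ≃ₜ X)
    (hΦ : ∀ P ∈ A.nondeg, Φ '' P.1 = (f P).1) :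
    ∃ φ : A.Space ≃ₜ B.Space, (∀ x, φ (A.q x) = B.q (Φ x)) ∧ ∀ P ∈ A.nondeg, φ P = f P := by
  have h1 : ∀ z, A.q z ∈ A.nondeg → B.q (Φ z) = f (A.q z) := fun z hz =>
    q_eq_of_mem (hΦ _ hz ▸ ⟨z, A.mem_q z, rfl⟩)
  have h2 : ∀ z, B.q (Φ z) ∈ B.nondeg → A.q z ∈ A.nondeg := by
    intro z hz
    rw [← hf] at hz
    obtain ⟨P, hP, hPz⟩ := hz
    have hmem : Φ z ∈ Φ '' P.1 := by
      rw [hΦ P hP, hPz]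
      exact B.mem_q _
    obtain ⟨w, hw, hwz⟩ := hmem
    rw [q_eq_of_mem (Φ.injective hwz ▸ hw : z ∈ P.1)]
    exact hP
  have h3 : ∀ z, A.q z ∈ A.nondeg → B.q (Φ z) ∈ B.nondeg := fun z hz =>
    h1 z hz ▸ hf ▸ mem_image_of_mem f hz
  have hfib : ∀ z z', A.q z = A.q z' ↔ B.q (Φ z) = B.q (Φ z') := by
    intro z z'
    by_cases hz : A.q z ∈ A.nondeg
    · constructor
      · intro h
        rw [h1 z hz, h1 z' (h ▸ hz), h]
      · intro h
        have hz' := h2 z' (h ▸ h3 z hz)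
        rw [h1 z hz, h1 z' hz'] at h
        exact hinj h
    · constructor
      · intro h
        rw [q_injective_of_notMem_nondeg hz h]
      · intro h
        rw [Φ.injective (q_injective_of_notMem_nondeg (fun hB => hz (h2 z hB)) h)]
  obtain ⟨φ, hφ⟩ := exists_homeomorph_of_isQuotientMap A.isQuotientMap_q
    (B.isQuotientMap_q.comp Φ.isQuotientMap) hfib
  refine ⟨φ, hφ, fun P hP => ?_⟩
  obtain ⟨z, rfl⟩ := A.q_surjective P
  exact (hφ z).trans (h1 z hP)

end Decomposition

/-- Theorem: for discrete decompositions `A`, `B` into singletons and members of a tame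
family `𝒦`, the `(A,B)`-liftable homeomorphisms are dense in the space `H°(A°,B°)` of
homeomorphisms of pairs, with the strong limitation topology. -/
theorem liftable_dense_discrete (X : Type*) [TopologicalSpace X]
    (hX : CompletelyMetrizable X) (hslh : StronglyLocallyHomogeneous X)
    (𝒦 : Set (Set X)) (h𝒦 : IsTameFamily 𝒦)
    (A B : Decomposition X)
    (hA𝒦 : ∀ P ∈ A.pieces, P ∈ 𝒦 ∨ ∃ x : X, P = {x})
    (hB𝒦 : ∀ P ∈ B.pieces, P ∈ 𝒦 ∨ ∃ x : X, P = {x})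
    (hAd : A.IsDiscreteDecomp) (hBd : B.IsDiscreteDecomp) :
    ∀ f : A.Space ≃ₜ B.Space, ⇑f '' A.nondeg = B.nondeg →
      ∀ 𝒲 : Set (Set B.Space), (∀ w ∈ 𝒲, IsOpen w) → B.nondeg ⊆ ⋃₀ 𝒲 →
        ∃ φ : A.Space ≃ₜ B.Space, Liftable A B φ ∧ ⇑φ '' A.nondeg = B.nondeg ∧
          Near ⇑f ⇑φ 𝒲 := by
  intro f hf 𝒲 h𝒲 hcov
  obtain ⟨-, hinv, hshr, hshift, -⟩ := h𝒦
  have hfB : ∀ P : A.nondeg, f P.1 ∈ B.nondeg := fun P => hf ▸ mem_image_of_mem f P.2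
  have hw : ∀ Q : B.nondeg, ∃ w ∈ 𝒲, Q.1 ∈ w := fun Q => hcov Q.2
  choose w hw𝒲 hQw using hw
  obtain ⟨V', hV'd, hV'⟩ := Decomposition.exists_open_expansion hX hBd
  let V : B.nondeg → Set X := fun Q => V' Q ∩ B.q ⁻¹' w Q
  have hVd : IsDiscreteFamily V := hV'd.mono fun Q => inter_subset_left
  have hVo : ∀ Q, IsOpen (V Q) := fun Q =>
    (hV' Q).1.inter ((h𝒲 _ (hw𝒲 Q)).preimage B.isQuotientMap_q.continuous)
  have hQV : ∀ Q, Q.1.1 ⊆ V Q := fun Q z hz => by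
    refine ⟨(hV' Q).2 hz, ?_⟩
    rw [mem_preimage, Decomposition.q_eq_of_mem hz]
    exact hQw Q
  obtain ⟨ηB, hηBmem, hηBoff, hηB⟩ := Decomposition.exists_homeomorph_space hX
    (fun P hP h => hshr _ (hinv h _ (Decomposition.mem_of_mem_nondeg hB𝒦 hP))) hVd hVo hQV
  have hηBV : ∀ Q : B.nondeg, ηB Q.1 ∈ V Q := fun Q => by
    obtain ⟨p, hp⟩ := B.nonempty' _ Q.1.2
    rw [← Decomposition.q_eq_of_mem hp]
    exact (hηBmem Q p).2 (hQV Q hp)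
  obtain ⟨U', hU'd, hU'⟩ := Decomposition.exists_open_expansion hX hAd
  let U : A.nondeg → Set X := fun P =>
    U' P ∩ (fun z => ηB (f (A.q z))) ⁻¹' V ⟨f P.1, hfB P⟩
  have hUd : IsDiscreteFamily U := hU'd.mono fun Q => inter_subset_left
  have hUo : ∀ P, IsOpen (U P) := fun P => (hU' P).1.inter ((hVo _).preimage
    (ηB.continuous.comp (f.continuous.comp A.isQuotientMap_q.continuous)))
  have hPU : ∀ P, P.1.1 ⊆ U P := fun P z hz => by
    refine ⟨(hU' P).2 hz, ?_⟩
    rw [mem_preimage, Decomposition.q_eq_of_mem hz]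
    exact hηBV ⟨f P.1, hfB P⟩
  obtain ⟨ηA, hηAmem, hηAoff, hηA⟩ := Decomposition.exists_homeomorph_space hX
    (fun P hP h => hshr _ (hinv h _ (Decomposition.mem_of_mem_nondeg hA𝒦 hP))) hUd hUo hPU
  let g : X ≃ₜ X := ηA.symm.trans (f.trans ηB)
  have hg : ∀ p, g (ηA p) = ηB (f p) := fun p => by simp [g]
  have hloc : ∀ P : A.nondeg, ∃ h t : X ≃ₜ X, (∀ z ∉ U P, h z = z) ∧
      (∀ z ∉ V ⟨f P.1, hfB P⟩, t z = z) ∧ ∀ z, t (g (h z)) ∈ (f P.1).1 ↔ z ∈ P.1.1 := by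
    intro P
    obtain ⟨S, hS, -, hSs⟩ := hshift (ηB (f P.1)) _ ((hVo _).mem_nhds (hηBV ⟨f P.1, hfB P⟩))
    obtain ⟨k, hk, hkS⟩ := hηB ⟨f P.1, hfB P⟩ S hS
    obtain ⟨h, hh, hhS⟩ := hηA P (g ⁻¹' S)
      (g.continuous.continuousAt.preimage_mem_nhds (by rwa [hg]))
    have hP𝒦 := Decomposition.mem_of_mem_nondeg hA𝒦 P.2
    have hQ𝒦 := Decomposition.mem_of_mem_nondeg hB𝒦 (hfB P)
    obtain ⟨s, hs, hsV⟩ := hSs _ (hinv g _ (hinv h _ hP𝒦)) _ (hinv k _ hQ𝒦)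
      (image_subset_iff.2 hhS) hkS
    refine ⟨h, s.trans k.symm, hh, fun z hz => ?_, fun z => ?_⟩
    · rw [Homeomorph.trans_apply, hsV z hz, Homeomorph.symm_apply_eq, hk z hz]
    · rw [Homeomorph.trans_apply, ← k.injective.mem_set_image,
        Homeomorph.apply_symm_apply, ← hs, s.injective.mem_set_image, g.injective.mem_set_image,
        h.injective.mem_set_image]
  choose h t hhU htV hht using hloc
  have hpre : ∀ Q : B.nondeg, ∃ P : A.nondeg, (⟨f P.1, hfB P⟩ : B.nondeg) = Q := by
    rintro ⟨Q, hQ⟩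
    rw [← hf] at hQ
    obtain ⟨P, hP, rfl⟩ := hQ
    exact ⟨⟨P, hP⟩, rfl⟩
  have hVd' : IsDiscreteFamily fun P : A.nondeg => V ⟨f P.1, hfB P⟩ := by
    intro z
    obtain ⟨N, hN, hN'⟩ := hVd z
    refine ⟨N, hN, fun P P' hP hP' => Subtype.ext (f.injective ?_)⟩
    exact congrArg Subtype.val (hN' _ _ hP hP')
  obtain ⟨h', hh'on, hh'off⟩ := exists_glue_homeomorph hUd h hhU
  obtain ⟨t', ht'on, ht'off⟩ := exists_glue_homeomorph hVd' t htV
  have hgU : ∀ P, ∀ z ∈ U P, g z ∈ V ⟨f P.1, hfB P⟩ := by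
    intro P z hz
    obtain ⟨p, rfl⟩ := ηA.surjective z
    obtain ⟨u, rfl⟩ := A.q_surjective p
    rw [hg]
    exact ((hηAmem P u).1 hz).2
  have ht'V : ∀ P, ∀ z ∈ V ⟨f P.1, hfB P⟩, t' z ∈ V ⟨f P.1, hfB P⟩ := fun P z hz => by
    rw [ht'on P z hz]
    exact ((t P).mem_iff_of_support (htV P) z).2 hz
  have hh'U : ∀ P, ∀ z ∈ U P, h' z ∈ U P := fun P z hz => by
    rw [hh'on P z hz]
    exact ((h P).mem_iff_of_support (hhU P) z).2 hz
  let Φ : X ≃ₜ X := h'.trans (g.trans t')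
  have hΦU : ∀ P, ∀ z ∈ U P, Φ z = t P (g (h P z)) := fun P z hz => by
    have : Φ z = t' (g (h' z)) := rfl
    rw [this, ht'on P _ (hgU P _ (hh'U P z hz)), hh'on P z hz]
  have hΦP : ∀ P ∈ A.nondeg, Φ '' P.1 = (f P).1 := by
    intro P hP
    refine Subset.antisymm ?_ fun y hy => ?_
    · rintro _ ⟨z, hz, rfl⟩
      rw [hΦU ⟨P, hP⟩ z (hPU ⟨P, hP⟩ hz)]
      exact (hht ⟨P, hP⟩ z).2 hz
    · let e : X ≃ₜ X := (h ⟨P, hP⟩).trans (g.trans (t ⟨P, hP⟩))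
      obtain ⟨z, rfl⟩ := e.surjective y
      have hz : z ∈ P.1 := (hht ⟨P, hP⟩ z).1 hy
      exact ⟨z, hz, hΦU ⟨P, hP⟩ z (hPU ⟨P, hP⟩ hz)⟩
  obtain ⟨φ, hφ, hφf⟩ := Decomposition.exists_homeomorph_of_image_eq f hf f.injective Φ hΦP
  refine ⟨φ, ⟨Φ, fun x => (hφ x).symm⟩, (image_congr hφf).trans hf, fun p hp => ?_⟩
  obtain ⟨z, rfl⟩ := A.q_surjective p
  rw [hφ] at hp ⊢
  obtain ⟨v, hv⟩ := B.q_surjective (f (A.q z))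
  have hclose : ∀ P : A.nondeg, g (h' z) ∈ V ⟨f P.1, hfB P⟩ →
      ηB (f (A.q z)) ∈ V ⟨f P.1, hfB P⟩ → ∃ W ∈ 𝒲, f (A.q z) ∈ W ∧ B.q (Φ z) ∈ W := by
    intro P hgz hfz
    refine ⟨w ⟨f P.1, hfB P⟩, hw𝒲 _, ?_, (ht'V P _ hgz).2⟩
    rw [← hv, hηBmem] at hfz
    rw [← hv]
    exact hfz.2
  by_cases hzU : ∃ P, z ∈ U P
  · obtain ⟨P, hP⟩ := hzU
    exact hclose P (hgU P _ (hh'U P z hP)) hP.2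
  · have hzU' : ∀ P, z ∉ U P := fun P hP => hzU ⟨P, hP⟩
    have hgz : g (h' z) = ηB (f (A.q z)) := by
      rw [hh'off z hzU', ← hg, hηAoff z hzU']
    by_cases hvV : ∃ Q, ηB (f (A.q z)) ∈ V Q
    · obtain ⟨Q, hQ⟩ := hvV
      obtain ⟨P, rfl⟩ := hpre Q
      exact hclose P (hgz ▸ hQ) hQ
    · have hvQ : ∀ Q, v ∉ V Q := fun Q hQ => hvV ⟨Q, by rw [← hv]; exact (hηBmem Q v).2 hQ⟩
      have hΦz : Φ z = v := by
        have : Φ z = t' (g (h' z)) := rfl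
        rw [this, hgz, ← hv, hηBoff v hvQ, ht'off v fun P => hvQ _]
      exact absurd (by rw [hΦz, hv]) hp

end
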